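/- Let X be a t-strongly log-concave random vector in ℝⁿ for some t > 0. Then X is (1/√t)-subgaussian: for every p ≥ 1 and every unit vector θ ∈ S^{n−1}, (𝔼|⟨X − 𝔼X, θ⟩|ᵖ)^{1/p} ≤ √(p/t). -/

import Mathlib

open MeasureTheory RealInnerProductSpace

noncomputable section

/-- A nonnegative function is log-concave if it satisfies
`f(t x + (1-t) y) ≥ f(x)^t f(y)^(1-t)`; this is equivalent to `f = e^{-V}`
for some convex function `V : ℝⁿ → ℝ ∪ {+∞}`. -/
def IsLogConcaveFun {E : Type*} [AddCommGroup E] [Module ℝ E] (f : E → ℝ) : Prop :=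
  (∀ x, 0 ≤ f x) ∧
  ∀ x y : E, ∀ t : ℝ, 0 ≤ t → t ≤ 1 →
    f x ^ t * f y ^ (1 - t) ≤ f (t • x + (1 - t) • y)

/-- A measure on `ℝⁿ` is `t`-strongly log-concave if it has a density `f` with
respect to Lebesgue measure such that `x ↦ f(x) e^{t ‖x‖² / 2}` is log-concave,
i.e. `f` is log-concave relatively to a Gaussian of variance `1/t`. -/
def IsStronglyLogConcaveMeasure {n : ℕ} (t : ℝ)
    (μ : Measure (EuclideanSpace ℝ (Fin n))) : Prop :=
  ∃ f : EuclideanSpace ℝ (Fin n) → ℝ,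
    μ = volume.withDensity (fun x => ENNReal.ofReal (f x)) ∧
    IsLogConcaveFun fun x => f x * Real.exp (t * ‖x‖ ^ 2 / 2)

/-- The mean (barycenter) of a measure on `ℝⁿ`, computed coordinatewise. -/
def meanVec {n : ℕ} (μ : Measure (EuclideanSpace ℝ (Fin n))) : EuclideanSpace ℝ (Fin n) :=
  (EuclideanSpace.equiv (Fin n) ℝ).symm fun i => ∫ x, x i ∂μ

open Set Filter Topology
open scoped ENNReal Pointwise

/-- One-dimensional Brunn-Minkowski inequality. -/
theorem volume_add_volume_le {A B C : Set ℝ} (hA : MeasurableSet A) (hB : MeasurableSet B)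
    (hA' : A.Nonempty) (hB' : B.Nonempty) (hC : A + B ⊆ C) :
    volume A + volume B ≤ volume C := by
  obtain ⟨a, ha⟩ := hA'
  obtain ⟨b, hb⟩ := hB'
  rcases eq_or_ne (volume A) 0 with hA0 | hA0
  · rw [hA0, zero_add, ← measure_preimage_add volume (-a) B]
    refine measure_mono fun x hx => hC ?_
    simpa using add_mem_add ha (mem_preimage.1 hx)
  rcases eq_or_ne (volume B) 0 with hB0 | hB0
  · rw [hB0, add_zero, ← measure_preimage_add_right volume (-b) A]
    refine measure_mono fun x hx => hC ?_
    simpa using add_mem_add (mem_preimage.1 hx) hb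
  refine le_of_forall_lt fun c hc => ?_
  obtain ⟨a', ha', b', hb', hc'⟩ := ENNReal.exists_lt_add_of_lt_add hc hA0 hB0
  obtain ⟨K, hKA, hK, haK⟩ := hA.exists_lt_isCompact ha'
  obtain ⟨L, hLB, hL, hbL⟩ := hB.exists_lt_isCompact hb'
  have hKne : K.Nonempty := nonempty_of_measure_ne_zero (pos_of_gt haK).ne'
  have hLne : L.Nonempty := nonempty_of_measure_ne_zero (pos_of_gt hbL).ne'
  obtain ⟨k, hkK, hk⟩ := hK.exists_isGreatest hKne
  obtain ⟨l, hlL, hl⟩ := hL.exists_isLeast hLne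
  have hKm : volume ((fun x => x + -l) ⁻¹' K) = volume K := measure_preimage_add_right ..
  have hLm : volume ((fun x => -k + x) ⁻¹' L) = volume L := measure_preimage_add ..
  calc c < a' + b' := hc'
    _ ≤ volume ((fun x => x + -l) ⁻¹' K) + volume ((fun x => -k + x) ⁻¹' L) := by
      rw [hKm, hLm]; gcongr
    _ = volume ((fun x => x + -l) ⁻¹' K ∪ (fun x => -k + x) ⁻¹' L) := by
      refine (measure_union₀ ((hL.measurableSet.preimage (by fun_prop)).nullMeasurableSet) ?_).symm
      refine measure_mono_null (t := {k + l}) ?_ (by simp)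
      rintro x ⟨hx1, hx2⟩
      have h1 := hk hx1
      have h2 := hl hx2
      simp only [mem_singleton_iff]
      linarith
    _ ≤ volume C := by
      refine measure_mono ?_
      rintro x (hx | hx) <;> refine hC ?_
      · simpa using add_mem_add (hKA hx) (hLB hlL)
      · simpa using add_mem_add (hKA hkK) (hLB hx)

/-- Weighted form of the one-dimensional Brunn-Minkowski inequality. -/
theorem ofReal_mul_volume_add_le {A B C : Set ℝ} {m : ℝ} (hm0 : 0 < m) (hm1 : m < 1)
    (hA : MeasurableSet A) (hB : MeasurableSet B) (hA' : A.Nonempty) (hB' : B.Nonempty)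
    (hC : ∀ x ∈ A, ∀ y ∈ B, m * x + (1 - m) * y ∈ C) :
    ENNReal.ofReal m * volume A + ENNReal.ofReal (1 - m) * volume B ≤ volume C := by
  have h := volume_add_volume_le (hA.const_smul₀ m) (hB.const_smul₀ (1 - m))
    hA'.smul_set hB'.smul_set (C := C) ?_
  · simpa [Measure.addHaar_smul, abs_of_pos hm0, abs_of_pos (sub_pos.2 hm1)] using h
  · rintro _ ⟨_, ⟨x, hx, rfl⟩, _, ⟨y, hy, rfl⟩, rfl⟩
    exact hC x hx y hy

theorem lintegral_eq_setLIntegral_Ioo_meas_lt {α : Type*} [MeasurableSpace α] {μ : Measure α}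
    {f : α → ℝ≥0∞} (hf : Measurable f) (hf1 : ∀ x, f x ≤ 1) :
    ∫⁻ x, f x ∂μ = ∫⁻ c in Ioo (0 : ℝ) 1, μ {x | ENNReal.ofReal c < f x} := by
  have hfin : ∀ x, f x ≠ ∞ := fun x => ((hf1 x).trans_lt ENNReal.one_lt_top).ne
  have h := lintegral_eq_lintegral_meas_lt μ (f := fun x => (f x).toReal)
    (ae_of_all _ fun x => ENNReal.toReal_nonneg) hf.ennreal_toReal.aemeasurable
  simp only [ENNReal.ofReal_toReal (hfin _)] at h
  rw [h, ← Ioo_union_Ici_eq_Ioi (zero_lt_one' ℝ),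
    lintegral_union measurableSet_Ici (Set.disjoint_left.2 fun x hx hx' => hx.2.not_ge hx'),
    setLIntegral_eq_zero (s := Ici 1) measurableSet_Ici, add_zero]
  · refine setLIntegral_congr_fun measurableSet_Ioo fun c hc => ?_
    simp only [ENNReal.ofReal_lt_iff_lt_toReal hc.1.le (hfin _)]
  · intro c hc
    have : {a | c < (f a).toReal} = ∅ := by
      refine eq_empty_of_forall_notMem fun x hx => ?_
      have h1 : (f x).toReal ≤ 1 := by
        simpa using ENNReal.toReal_mono ENNReal.one_ne_top (hf1 x)
      exact (lt_of_le_of_lt hc hx).not_ge h1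
    simp [this]

theorem ENNReal.rpow_mul_rpow_le_add {m : ℝ} (hm0 : 0 < m) (hm1 : m < 1) (a b : ℝ≥0∞) :
    a ^ m * b ^ (1 - m) ≤ ENNReal.ofReal m * a + ENNReal.ofReal (1 - m) * b := by
  have hm1' : 0 < 1 - m := sub_pos.2 hm1
  have h := ENNReal.young_inequality (a ^ m) (b ^ (1 - m)) (p := m⁻¹) (q := (1 - m)⁻¹)
    (Real.HolderConjugate.inv_inv hm0 hm1' (by ring))
  rwa [← ENNReal.rpow_mul, ← ENNReal.rpow_mul, mul_inv_cancel₀ hm0.ne', mul_inv_cancel₀ hm1'.ne',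
    ENNReal.rpow_one, ENNReal.rpow_one, ENNReal.ofReal_inv_of_pos hm0,
    ENNReal.ofReal_inv_of_pos hm1', div_eq_mul_inv, div_eq_mul_inv, inv_inv, inv_inv, mul_comm a,
    mul_comm b] at h

theorem ENNReal.rpow_mul_rpow_one_sub {m : ℝ} (hm0 : 0 < m) (hm1 : m < 1) (a : ℝ≥0∞) :
    a ^ m * a ^ (1 - m) = a := by
  rw [← ENNReal.rpow_add_of_nonneg _ _ hm0.le (sub_pos.2 hm1).le]; simp

/-- A measure satisfies the Prékopa-Leindler inequality. -/
def PrekopaLeindler {E : Type*} [AddCommGroup E] [Module ℝ E] [MeasurableSpace E]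
    (μ : Measure E) : Prop :=
  ∀ m : ℝ, 0 < m → m < 1 → ∀ f g h : E → ℝ≥0∞, Measurable f → Measurable g → Measurable h →
    (∀ x y, f x ^ m * g y ^ (1 - m) ≤ h (m • x + (1 - m) • y)) →
    (∫⁻ x, f x ∂μ) ^ m * (∫⁻ x, g x ∂μ) ^ (1 - m) ≤ ∫⁻ x, h x ∂μ

theorem prekopa_leindler_of_iSup_eq_one {m : ℝ} (hm0 : 0 < m) (hm1 : m < 1) {f g h : ℝ → ℝ≥0∞}
    (hf : Measurable f) (hg : Measurable g) (hh : Measurable h)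
    (hfgh : ∀ x y, f x ^ m * g y ^ (1 - m) ≤ h (m • x + (1 - m) • y))
    (hf1 : ⨆ x, f x = 1) (hg1 : ⨆ x, g x = 1) :
    (∫⁻ x, f x) ^ m * (∫⁻ x, g x) ^ (1 - m) ≤ ∫⁻ x, h x := by
  have hm1' : 0 < 1 - m := sub_pos.2 hm1
  refine (ENNReal.rpow_mul_rpow_le_add hm0 hm1 _ _).trans ?_
  have hmin : ∫⁻ x, min (h x) 1 ≤ ∫⁻ x, h x := lintegral_mono fun x => min_le_left _ _
  refine le_trans ?_ hmin
  rw [lintegral_eq_setLIntegral_Ioo_meas_lt hf fun x => hf1 ▸ le_iSup f x,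
    lintegral_eq_setLIntegral_Ioo_meas_lt hg fun x => hg1 ▸ le_iSup g x,
    lintegral_eq_setLIntegral_Ioo_meas_lt (hh.min measurable_const) fun x => min_le_right _ _,
    ← lintegral_const_mul' _ _ ENNReal.ofReal_ne_top,
    ← lintegral_const_mul' _ _ ENNReal.ofReal_ne_top, ← lintegral_add_left]
  · refine setLIntegral_mono' measurableSet_Ioo fun c hc => ?_
    have hc1 : ENNReal.ofReal c < 1 := by simpa using hc.2
    refine ofReal_mul_volume_add_le hm0 hm1 (measurableSet_lt measurable_const hf)
      (measurableSet_lt measurable_const hg) (lt_iSup_iff.1 (hc1.trans_eq hf1.symm))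
      (lt_iSup_iff.1 (hc1.trans_eq hg1.symm)) fun x hx y hy => lt_min ?_ hc1
    refine lt_of_lt_of_le ?_ (hfgh x y)
    rw [← ENNReal.rpow_mul_rpow_one_sub hm0 hm1 (ENNReal.ofReal c)]
    exact ENNReal.mul_lt_mul (ENNReal.rpow_lt_rpow hx hm0) (ENNReal.rpow_lt_rpow hy hm1')
  · refine Measurable.const_mul ?_ _
    exact Antitone.measurable fun c d hcd => measure_mono fun x hx =>
      (ENNReal.ofReal_le_ofReal hcd).trans_lt hx

theorem prekopa_leindler_of_bounded {m : ℝ} (hm0 : 0 < m) (hm1 : m < 1) {f g h : ℝ → ℝ≥0∞}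
    (hf : Measurable f) (hg : Measurable g) (hh : Measurable h)
    (hfgh : ∀ x y, f x ^ m * g y ^ (1 - m) ≤ h (m • x + (1 - m) • y))
    (hfb : ⨆ x, f x ≠ ∞) (hgb : ⨆ x, g x ≠ ∞) :
    (∫⁻ x, f x) ^ m * (∫⁻ x, g x) ^ (1 - m) ≤ ∫⁻ x, h x := by
  have hm1' : 0 < 1 - m := sub_pos.2 hm1
  set S := ⨆ x, f x with hS
  set T := ⨆ x, g x with hT
  rcases eq_or_ne S 0 with hS0 | hS0
  · have : ∀ x, f x = 0 := fun x => le_antisymm ((le_iSup f x).trans_eq hS0) zero_le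
    simp [this, ENNReal.zero_rpow_of_pos hm0]
  rcases eq_or_ne T 0 with hT0 | hT0
  · have : ∀ x, g x = 0 := fun x => le_antisymm ((le_iSup g x).trans_eq hT0) zero_le
    simp [this, ENNReal.zero_rpow_of_pos hm1']
  set R := (S⁻¹) ^ m * (T⁻¹) ^ (1 - m) with hR
  have hR0 : R ≠ 0 := by simp [hR, hm0.le, hm1.le, hfb, hgb, ENNReal.rpow_eq_zero_iff]
  have hRt : R ≠ ∞ := by
    refine ENNReal.mul_ne_top ?_ ?_ <;> refine ENNReal.rpow_ne_top_of_nonneg (by linarith) ?_ <;>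
    simpa
  have key := prekopa_leindler_of_iSup_eq_one hm0 hm1 (f := fun x => S⁻¹ * f x)
    (g := fun x => T⁻¹ * g x) (h := fun x => R * h x) (hf.const_mul _) (hg.const_mul _)
    (hh.const_mul _) (fun x y => ?_) ?_ ?_
  · rw [lintegral_const_mul _ hf, lintegral_const_mul _ hg, lintegral_const_mul _ hh,
      ENNReal.mul_rpow_of_nonneg _ _ hm0.le, ENNReal.mul_rpow_of_nonneg _ _ hm1'.le,
      mul_mul_mul_comm, ← hR] at key
    exact (ENNReal.mul_le_mul_iff_right hR0 hRt).1 key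
  · rw [ENNReal.mul_rpow_of_nonneg _ _ hm0.le, ENNReal.mul_rpow_of_nonneg _ _ hm1'.le,
      mul_mul_mul_comm, ← hR]
    gcongr
    exact hfgh x y
  · rw [← ENNReal.mul_iSup, ← hS, ENNReal.inv_mul_cancel hS0 hfb]
  · rw [← ENNReal.mul_iSup, ← hT, ENNReal.inv_mul_cancel hT0 hgb]

theorem lintegral_eq_iSup_lintegral_min {α : Type*} [MeasurableSpace α] {μ : Measure α}
    {f : α → ℝ≥0∞} (hf : Measurable f) :
    ∫⁻ x, f x ∂μ = ⨆ k : ℕ, ∫⁻ x, min (f x) k ∂μ := by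
  rw [← lintegral_iSup (fun k => hf.min measurable_const)]
  · refine lintegral_congr fun x => ?_
    have : ⨆ k : ℕ, (k : ℝ≥0∞) = ∞ := ENNReal.iSup_natCast
    rw [← inf_iSup_eq, this, inf_top_eq]
  · intro i j hij x
    have : (i : ℝ≥0∞) ≤ j := by exact_mod_cast hij
    exact min_le_min le_rfl this

theorem prekopaLeindler_real : PrekopaLeindler (volume : Measure ℝ) := by
  intro m hm0 hm1 f g h hf hg hh hfgh
  have hm1' : 0 < 1 - m := sub_pos.2 hm1
  have hlim : ∀ {f : ℝ → ℝ≥0∞}, Measurable f →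
      Tendsto (fun k : ℕ => ∫⁻ x, min (f x) k) atTop (𝓝 (∫⁻ x, f x)) := by
    intro f hf
    rw [lintegral_eq_iSup_lintegral_min hf]
    refine tendsto_atTop_iSup fun i j hij => lintegral_mono fun x => ?_
    have : (i : ℝ≥0∞) ≤ j := by exact_mod_cast hij
    exact min_le_min le_rfl this
  refine ENNReal.mul_le_of_forall_lt fun a ha b hb => ?_
  have h1 := ((ENNReal.continuous_rpow_const.tendsto _).comp (hlim hf)).eventually_const_lt ha
  have h2 := ((ENNReal.continuous_rpow_const.tendsto _).comp (hlim hg)).eventually_const_lt hb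
  obtain ⟨k, hk1, hk2⟩ := (h1.and h2).exists
  refine (mul_le_mul' hk1.le hk2.le).trans ?_
  refine prekopa_leindler_of_bounded hm0 hm1 (hf.min measurable_const) (hg.min measurable_const)
    hh (fun x y => le_trans ?_ (hfgh x y)) ?_ ?_
  · gcongr <;> exact min_le_left _ _
  · exact ((iSup_le fun x => min_le_right _ _).trans_lt (ENNReal.natCast_lt_top k)).ne
  · exact ((iSup_le fun x => min_le_right _ _).trans_lt (ENNReal.natCast_lt_top k)).ne

theorem PrekopaLeindler.prod {E F : Type*} [AddCommGroup E] [Module ℝ E] [MeasurableSpace E]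
    [AddCommGroup F] [Module ℝ F] [MeasurableSpace F] {μ : Measure E} {ν : Measure F}
    [SFinite μ] [SFinite ν] (hμ : PrekopaLeindler μ) (hν : PrekopaLeindler ν) :
    PrekopaLeindler (μ.prod ν) := by
  intro m hm0 hm1 f g h hf hg hh hfgh
  rw [lintegral_prod _ hf.aemeasurable, lintegral_prod _ hg.aemeasurable,
    lintegral_prod _ hh.aemeasurable]
  refine hμ m hm0 hm1 _ _ _ hf.lintegral_prod_right' hg.lintegral_prod_right'
    hh.lintegral_prod_right' fun x x' => ?_
  exact hν m hm0 hm1 _ _ _ (hf.comp measurable_prodMk_left) (hg.comp measurable_prodMk_left)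
    (hh.comp measurable_prodMk_left) fun y y' => hfgh (x, y) (x', y')

/-- The Prékopa-Leindler inequality is transported by linear equivalences. -/
theorem PrekopaLeindler.map {E F : Type*} [AddCommGroup E] [Module ℝ E] [MeasurableSpace E]
    [AddCommGroup F] [Module ℝ F] [MeasurableSpace F] {μ : Measure E} {ν : Measure F}
    (hμ : PrekopaLeindler μ) (L : E →ₗ[ℝ] F) (hL : MeasurePreserving L μ ν) :
    PrekopaLeindler ν := by
  intro m hm0 hm1 f g h hf hg hh hfgh
  rw [← hL.lintegral_comp hf, ← hL.lintegral_comp hg, ← hL.lintegral_comp hh]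
  refine hμ m hm0 hm1 _ _ _ (hf.comp hL.measurable) (hg.comp hL.measurable)
    (hh.comp hL.measurable) fun x y => ?_
  simpa using hfgh (L x) (L y)

theorem prekopaLeindler_pi (n : ℕ) : PrekopaLeindler (volume : Measure (Fin n → ℝ)) := by
  induction n with
  | zero =>
    intro m hm0 hm1 f g h hf hg hh hfgh
    rw [volume_pi, Measure.pi_of_empty _ 0]
    simpa using hfgh 0 0
  | succ n ih =>
    refine (prekopaLeindler_real.prod ih).map
      (Fin.consLinearEquiv ℝ (fun _ : Fin (n + 1) => ℝ)).toLinearMap ?_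
    have h := (volume_preserving_piFinSuccAbove (fun _ : Fin (n + 1) => ℝ) 0).symm
    convert! h using 1
    ext p i
    simp [MeasurableEquiv.piFinSuccAbove, Fin.consLinearEquiv]

theorem prekopaLeindler_euclideanSpace (n : ℕ) :
    PrekopaLeindler (volume : Measure (EuclideanSpace ℝ (Fin n))) :=
  (prekopaLeindler_pi n).map (WithLp.linearEquiv 2 ℝ (Fin n → ℝ)).symm.toLinearMap
    (PiLp.volume_preserving_toLp (Fin n))

/-- The largest lower semicontinuous function below `g`. -/
def lscEnvelope {E : Type*} [TopologicalSpace E] (g : E → ℝ≥0∞) (x : E) : ℝ≥0∞ :=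
  ⨆ c : ℝ≥0∞, (interior {y | c ≤ g y}).indicator (fun _ => c) x

theorem lowerSemicontinuous_lscEnvelope {E : Type*} [TopologicalSpace E] (g : E → ℝ≥0∞) :
    LowerSemicontinuous (lscEnvelope g) :=
  lowerSemicontinuous_iSup fun _ => isOpen_interior.lowerSemicontinuous_indicator zero_le

theorem le_lscEnvelope {E : Type*} [TopologicalSpace E] {g : E → ℝ≥0∞} {c : ℝ≥0∞} {x : E}
    (hx : x ∈ interior {y | c ≤ g y}) : c ≤ lscEnvelope g x := by
  refine le_trans ?_ (le_iSup _ c)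
  rw [indicator_of_mem hx]

theorem lscEnvelope_le {E : Type*} [TopologicalSpace E] (g : E → ℝ≥0∞) (x : E) :
    lscEnvelope g x ≤ g x :=
  iSup_le fun c => indicator_apply_le' (fun hx => interior_subset (s := {y | c ≤ g y}) hx)
    fun _ => zero_le

theorem lt_lscEnvelope_iff {E : Type*} [TopologicalSpace E] {g : E → ℝ≥0∞} {a : ℝ≥0∞} {x : E} :
    a < lscEnvelope g x ↔ ∃ c, a < c ∧ x ∈ interior {y | c ≤ g y} := by
  refine ⟨fun h => ?_, fun ⟨c, hac, hx⟩ => hac.trans_le (le_lscEnvelope hx)⟩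
  obtain ⟨c, hc⟩ := lt_iSup_iff.1 h
  by_cases hx : x ∈ interior {y | c ≤ g y}
  · exact ⟨c, by rwa [indicator_of_mem hx] at hc, hx⟩
  · simp [indicator_of_notMem hx] at hc

/-- Log-concavity for extended nonnegative functions. -/
def LogConcaveENNReal {E : Type*} [AddCommGroup E] [Module ℝ E] (g : E → ℝ≥0∞) : Prop :=
  ∀ m : ℝ, 0 < m → m < 1 → ∀ x y, g x ^ m * g y ^ (1 - m) ≤ g (m • x + (1 - m) • y)

theorem LogConcaveENNReal.le_of_le {E : Type*} [AddCommGroup E] [Module ℝ E] {g : E → ℝ≥0∞}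
    (hg : LogConcaveENNReal g) {m : ℝ} (hm0 : 0 < m) (hm1 : m < 1) {x y : E} {a b : ℝ≥0∞}
    (hx : a ≤ g x) (hy : b ≤ g y) : a ^ m * b ^ (1 - m) ≤ g (m • x + (1 - m) • y) := by
  have hm1' : 0 < 1 - m := sub_pos.2 hm1
  exact (mul_le_mul' (ENNReal.rpow_le_rpow hx hm0.le) (ENNReal.rpow_le_rpow hy hm1'.le)).trans
    (hg m hm0 hm1 x y)

theorem LogConcaveENNReal.lscEnvelope {E : Type*} [AddCommGroup E] [Module ℝ E]
    [TopologicalSpace E] [IsTopologicalAddGroup E] [ContinuousSMul ℝ E] {g : E → ℝ≥0∞}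
    (hg : LogConcaveENNReal g) : LogConcaveENNReal (lscEnvelope g) := by
  intro m hm0 hm1 x y
  have hm1' : 0 < 1 - m := sub_pos.2 hm1
  refine ENNReal.mul_le_of_forall_lt fun a ha b hb => ?_
  rw [← ENNReal.rpow_inv_lt_iff hm0] at ha
  rw [← ENNReal.rpow_inv_lt_iff hm1'] at hb
  obtain ⟨c, hac, hc⟩ := lt_lscEnvelope_iff.1 ha
  obtain ⟨d, hbd, hd⟩ := lt_lscEnvelope_iff.1 hb
  rw [ENNReal.rpow_inv_lt_iff hm0] at hac
  rw [ENNReal.rpow_inv_lt_iff hm1'] at hbd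
  refine (mul_le_mul' hac.le hbd.le).trans (le_lscEnvelope ?_)
  refine interior_maximal ?_ (((isOpen_interior (s := {y | c ≤ g y})).smul₀ hm0.ne').add_right
    (t := (1 - m) • interior {y | d ≤ g y}))
    (add_mem_add (smul_mem_smul_set hc) (smul_mem_smul_set hd))
  rintro _ ⟨_, ⟨u, hu, rfl⟩, _, ⟨v, hv, rfl⟩, rfl⟩
  exact hg.le_of_le hm0 hm1 (interior_subset (s := {y | c ≤ g y}) hu)
    (interior_subset (s := {y | d ≤ g y}) hv)

theorem LogConcaveENNReal.convex_superlevel {E : Type*} [AddCommGroup E] [Module ℝ E]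
    {g : E → ℝ≥0∞} (hg : LogConcaveENNReal g) (c : ℝ≥0∞) : Convex ℝ {x | c ≤ g x} := by
  refine convex_iff_forall_pos.2 fun x hx y hy a b ha hb hab => ?_
  obtain rfl : b = 1 - a := by linarith
  have h := hg.le_of_le ha (by linarith) hx hy
  rwa [ENNReal.rpow_mul_rpow_one_sub ha (by linarith)] at h

theorem LogConcaveENNReal.lscEnvelope_ae_eq {E : Type*} [NormedAddCommGroup E] [NormedSpace ℝ E]
    [MeasurableSpace E] [BorelSpace E] [FiniteDimensional ℝ E] {g : E → ℝ≥0∞}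
    (hg : LogConcaveENNReal g) (μ : Measure E) [μ.IsAddHaarMeasure] :
    _root_.lscEnvelope g =ᵐ[μ] g := by
  have h : ∀ᵐ x ∂μ, ∀ q : ℚ, x ∉ frontier {x | (Real.toNNReal q : ℝ≥0∞) ≤ g x} :=
    ae_all_iff.2 fun q => measure_eq_zero_iff_ae_notMem.1
      ((hg.convex_superlevel _).addHaar_frontier μ)
  filter_upwards [h] with x hx
  refine le_antisymm (lscEnvelope_le g x) (le_of_not_gt fun hlt => ?_)
  obtain ⟨q, -, hq1, hq2⟩ := ENNReal.lt_iff_exists_rat_btwn.1 hlt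
  refine (hq1.trans_le (le_lscEnvelope ?_)).false
  by_contra hn
  exact hx q ⟨subset_closure hq2.le, hn⟩

theorem IsStronglyLogConcaveMeasure.exists_measurable_logConcave {n : ℕ} {t : ℝ}
    {μ : Measure (EuclideanSpace ℝ (Fin n))} (hμ : IsStronglyLogConcaveMeasure t μ) :
    ∃ G : EuclideanSpace ℝ (Fin n) → ℝ≥0∞, Measurable G ∧ LogConcaveENNReal G ∧
      μ = volume.withDensity fun x => G x * ENNReal.ofReal (Real.exp (-(t * ‖x‖ ^ 2 / 2))) := by
  obtain ⟨f, hμf, hf0, hf⟩ := hμ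
  set g : EuclideanSpace ℝ (Fin n) → ℝ≥0∞ :=
    fun x => ENNReal.ofReal (f x * Real.exp (t * ‖x‖ ^ 2 / 2)) with hg
  have hglc : LogConcaveENNReal g := by
    intro m hm0 hm1 x y
    have hm1' : 0 < 1 - m := sub_pos.2 hm1
    rw [hg]
    simp only
    rw [ENNReal.ofReal_rpow_of_nonneg (hf0 x) hm0.le, ENNReal.ofReal_rpow_of_nonneg (hf0 y) hm1'.le,
      ← ENNReal.ofReal_mul (Real.rpow_nonneg (hf0 x) _)]
    exact ENNReal.ofReal_le_ofReal (hf x y m hm0.le hm1.le)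
  refine ⟨lscEnvelope g, (lowerSemicontinuous_lscEnvelope g).measurable, hglc.lscEnvelope, ?_⟩
  rw [hμf]
  refine withDensity_congr_ae ?_
  filter_upwards [hglc.lscEnvelope_ae_eq volume] with x hx
  rw [hx, hg, ← ENNReal.ofReal_mul (hf0 x), mul_assoc, ← Real.exp_add, add_neg_cancel,
    Real.exp_zero, mul_one]

theorem norm_convexCombination_sq_le {E : Type*} [NormedAddCommGroup E] [NormedSpace ℝ E]
    {m : ℝ} (hm0 : 0 ≤ m) (hm1 : m ≤ 1) (x y : E) :
    ‖m • x + (1 - m) • y‖ ^ 2 ≤ m * ‖x‖ ^ 2 + (1 - m) * ‖y‖ ^ 2 := by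
  have h : ‖m • x + (1 - m) • y‖ ≤ m * ‖x‖ + (1 - m) * ‖y‖ := by
    refine (norm_add_le _ _).trans_eq ?_
    rw [norm_smul, norm_smul, Real.norm_of_nonneg hm0, Real.norm_of_nonneg (sub_nonneg.2 hm1)]
  calc _ ≤ (m * ‖x‖ + (1 - m) * ‖y‖) ^ 2 := by gcongr
    _ ≤ _ := by nlinarith [mul_nonneg (mul_nonneg hm0 (sub_nonneg.2 hm1)) (sq_nonneg (‖x‖ - ‖y‖))]

/-- The Laplace transform of a marginal, normalized by that of the Gaussian of variance `1/t`. -/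
def normalizedLaplace {n : ℕ} (t : ℝ) (μ : Measure (EuclideanSpace ℝ (Fin n)))
    (θ : EuclideanSpace ℝ (Fin n)) (s : ℝ) : ℝ≥0∞ :=
  ∫⁻ x, ENNReal.ofReal (Real.exp (s * ⟪x, θ⟫ - s ^ 2 / (2 * t))) ∂μ

theorem logConcave_normalizedLaplace {n : ℕ} {t : ℝ} (ht : 0 < t)
    {μ : Measure (EuclideanSpace ℝ (Fin n))} (hμ : IsStronglyLogConcaveMeasure t μ)
    {θ : EuclideanSpace ℝ (Fin n)} (hθ : ‖θ‖ = 1) :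
    LogConcaveENNReal (normalizedLaplace t μ θ) := by
  obtain ⟨G, hGm, hG, hμG⟩ := hμ.exists_measurable_logConcave
  have hL : ∀ s, normalizedLaplace t μ θ s =
      ∫⁻ x, G x * ENNReal.ofReal (Real.exp (-(t / 2 * ‖x - (s / t) • θ‖ ^ 2))) := by
    intro s
    rw [normalizedLaplace, hμG, lintegral_withDensity_eq_lintegral_mul _ (by fun_prop) (by fun_prop)]
    refine lintegral_congr fun x => ?_
    rw [Pi.mul_apply, mul_assoc, ← ENNReal.ofReal_mul (Real.exp_nonneg _), ← Real.exp_add,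
      norm_sub_sq_real, norm_smul, hθ, inner_smul_right, mul_one, Real.norm_eq_abs, sq_abs]
    congr 3
    field_simp
    ring
  intro m hm0 hm1 s s'
  have hm1' : 0 < 1 - m := sub_pos.2 hm1
  rw [hL, hL, hL]
  refine prekopaLeindler_euclideanSpace n m hm0 hm1 _ _ _ (by fun_prop) (by fun_prop) (by fun_prop)
    fun x y => ?_
  rw [ENNReal.mul_rpow_of_nonneg _ _ hm0.le, ENNReal.mul_rpow_of_nonneg _ _ hm1'.le,
    mul_mul_mul_comm]
  refine mul_le_mul' (hG m hm0 hm1 x y) ?_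
  rw [ENNReal.ofReal_rpow_of_nonneg (Real.exp_nonneg _) hm0.le,
    ENNReal.ofReal_rpow_of_nonneg (Real.exp_nonneg _) hm1'.le,
    ← ENNReal.ofReal_mul (by positivity), ← Real.exp_mul, ← Real.exp_mul, ← Real.exp_add]
  refine ENNReal.ofReal_le_ofReal (Real.exp_le_exp.2 ?_)
  have h := norm_convexCombination_sq_le hm0.le hm1.le (x - (s / t) • θ) (y - (s' / t) • θ)
  have he : m • x + (1 - m) • y - ((m • s + (1 - m) • s') / t) • θ
      = m • (x - (s / t) • θ) + (1 - m) • (y - (s' / t) • θ) := by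
    simp only [smul_eq_mul]
    module
  rw [he]
  nlinarith

section Laplace

open ProbabilityTheory

variable {n : ℕ} {t : ℝ} {μ : Measure (EuclideanSpace ℝ (Fin n))}
  {θ : EuclideanSpace ℝ (Fin n)}

theorem normalizedLaplace_zero [IsProbabilityMeasure μ] : normalizedLaplace t μ θ 0 = 1 := by
  simp [normalizedLaplace]

theorem normalizedLaplace_ne_zero [IsProbabilityMeasure μ]
    (s : ℝ) : normalizedLaplace t μ θ s ≠ 0 := by
  rw [normalizedLaplace, ne_eq, lintegral_eq_zero_iff (by fun_prop)]
  intro h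
  obtain ⟨x, hx⟩ := h.exists
  exact (ENNReal.ofReal_pos.2 (Real.exp_pos _)).ne' hx

theorem normalizedLaplace_ne_top [IsProbabilityMeasure μ] (ht : 0 < t)
    (hμ : IsStronglyLogConcaveMeasure t μ)
    (hθ : ‖θ‖ = 1) (s : ℝ) : normalizedLaplace t μ θ s ≠ ∞ := by
  intro hs
  have h := logConcave_normalizedLaplace ht hμ hθ (1 / 2) (by norm_num) (by norm_num) s (-s)
  have h0 : (1 / 2 : ℝ) • s + (1 - 1 / 2 : ℝ) • (-s) = 0 := by simp only [smul_eq_mul]; ring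
  rw [h0, normalizedLaplace_zero, hs, ENNReal.top_rpow_of_pos (by norm_num), ENNReal.top_mul] at h
  · simp at h
  · refine (ENNReal.rpow_pos_of_nonneg ?_ (by norm_num)).ne'
    exact pos_iff_ne_zero.2 (normalizedLaplace_ne_zero _)

theorem integrable_exp_mul_inner [IsProbabilityMeasure μ] (ht : 0 < t)
    (hμ : IsStronglyLogConcaveMeasure t μ)
    (hθ : ‖θ‖ = 1) (s : ℝ) : Integrable (fun x => Real.exp (s * ⟪x, θ⟫)) μ := by
  have h : Integrable (fun x => Real.exp (s * ⟪x, θ⟫ - s ^ 2 / (2 * t))) μ := by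
    refine ⟨by fun_prop, ?_⟩
    rw [hasFiniteIntegral_iff_ofReal (ae_of_all _ fun x => (Real.exp_pos _).le)]
    exact (normalizedLaplace_ne_top ht hμ hθ s).lt_top
  simp_rw [Real.exp_sub] at h
  exact (h.mul_const (Real.exp (s ^ 2 / (2 * t)))).congr
    (ae_of_all _ fun x => div_mul_cancel₀ _ (Real.exp_pos _).ne')

theorem integrableExpSet_inner [IsProbabilityMeasure μ] (ht : 0 < t)
    (hμ : IsStronglyLogConcaveMeasure t μ)
    (hθ : ‖θ‖ = 1) : integrableExpSet (fun x => ⟪x, θ⟫) μ = univ :=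
  eq_univ_of_forall fun s => integrable_exp_mul_inner ht hμ hθ s

theorem toReal_normalizedLaplace (s : ℝ) : (normalizedLaplace t μ θ s).toReal
      = mgf (fun x => ⟪x, θ⟫) μ s / Real.exp (s ^ 2 / (2 * t)) := by
  rw [normalizedLaplace, ← integral_eq_lintegral_of_nonneg_ae
    (ae_of_all _ fun x => (Real.exp_pos _).le) (by fun_prop), mgf]
  simp_rw [Real.exp_sub]
  rw [integral_div]

theorem log_toReal_normalizedLaplace [IsProbabilityMeasure μ] (ht : 0 < t)
    (hμ : IsStronglyLogConcaveMeasure t μ)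
    (hθ : ‖θ‖ = 1) (s : ℝ) : Real.log (normalizedLaplace t μ θ s).toReal
      = cgf (fun x => ⟪x, θ⟫) μ s - s ^ 2 / (2 * t) := by
  rw [toReal_normalizedLaplace, Real.log_div
    (mgf_pos (integrable_exp_mul_inner ht hμ hθ s)).ne' (Real.exp_pos _).ne', Real.log_exp, cgf]

theorem concaveOn_cgf_inner_sub [IsProbabilityMeasure μ] (ht : 0 < t)
    (hμ : IsStronglyLogConcaveMeasure t μ)
    (hθ : ‖θ‖ = 1) :
    ConcaveOn ℝ univ fun s => cgf (fun x => ⟪x, θ⟫) μ s - s ^ 2 / (2 * t) := by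
  refine concaveOn_iff_forall_pos.2 ⟨convex_univ, fun s _ s' _ a b ha hb hab => ?_⟩
  obtain rfl : b = 1 - a := by linarith
  simp only [← log_toReal_normalizedLaplace ht hμ hθ, smul_eq_mul]
  have hpos : ∀ s, 0 < (normalizedLaplace t μ θ s).toReal := fun s =>
    ENNReal.toReal_pos (normalizedLaplace_ne_zero s) (normalizedLaplace_ne_top ht hμ hθ s)
  rw [← Real.log_rpow (hpos s), ← Real.log_rpow (hpos s'),
    ← Real.log_mul (Real.rpow_pos_of_pos (hpos s) _).ne' (Real.rpow_pos_of_pos (hpos s') _).ne',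
    ENNReal.toReal_rpow, ENNReal.toReal_rpow, ← ENNReal.toReal_mul]
  refine Real.log_le_log ?_ (ENNReal.toReal_mono (normalizedLaplace_ne_top ht hμ hθ _)
    (logConcave_normalizedLaplace ht hμ hθ a ha (by linarith) s s'))
  rw [ENNReal.toReal_mul, ← ENNReal.toReal_rpow, ← ENNReal.toReal_rpow]
  exact mul_pos (Real.rpow_pos_of_pos (hpos s) _) (Real.rpow_pos_of_pos (hpos s') _)

theorem cgf_inner_le [IsProbabilityMeasure μ] (ht : 0 < t) (hμ : IsStronglyLogConcaveMeasure t μ)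
    (hθ : ‖θ‖ = 1) (s : ℝ) :
    cgf (fun x => ⟪x, θ⟫) μ s ≤ s * (∫ x, ⟪x, θ⟫ ∂μ) + s ^ 2 / (2 * t) := by
  set Z : EuclideanSpace ℝ (Fin n) → ℝ := fun x => ⟪x, θ⟫ with hZ
  have hmem : (0 : ℝ) ∈ interior (integrableExpSet Z μ) := by
    simp [hZ, integrableExpSet_inner ht hμ hθ]
  have hcgf : HasDerivAt (cgf Z μ) (∫ x, Z x ∂μ) 0 := by
    have h := (analyticAt_cgf hmem).differentiableAt.hasDerivAt
    rwa [deriv_cgf_zero hmem, probReal_univ, div_one] at h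
  have hd : HasDerivAt (fun s => cgf Z μ s - s ^ 2 / (2 * t)) (∫ x, Z x ∂μ) 0 := by
    convert! hcgf.sub ((hasDerivAt_pow 2 (0 : ℝ)).div_const (2 * t)) using 1
    simp
  have hc := concaveOn_cgf_inner_sub ht hμ hθ
  rcases lt_trichotomy s 0 with hs | rfl | hs
  · have h := hc.le_slope_of_hasDerivAt (mem_univ s) (mem_univ 0) hs hd
    rw [slope_def_field, le_div_iff₀ (by linarith)] at h
    simp at h
    linarith
  · simp
  · have h := hc.slope_le_of_hasDerivAt (mem_univ 0) (mem_univ s) hs hd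
    rw [slope_def_field, div_le_iff₀ (by linarith)] at h
    simp at h
    linarith

theorem inner_meanVec [IsProbabilityMeasure μ] (ht : 0 < t) (hμ : IsStronglyLogConcaveMeasure t μ) :
    ⟪meanVec μ, θ⟫ = ∫ x, ⟪x, θ⟫ ∂μ := by
  have hint : ∀ i, Integrable (fun x : EuclideanSpace ℝ (Fin n) => x i) μ := by
    intro i
    have hi : ‖EuclideanSpace.single i (1 : ℝ)‖ = 1 := by simp
    have hmem : (0 : ℝ) ∈ interior (integrableExpSet
        (fun x : EuclideanSpace ℝ (Fin n) => ⟪x, EuclideanSpace.single i (1 : ℝ)⟫) μ) := by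
      simp only [integrableExpSet_inner ht hμ hi, interior_univ, mem_univ]
    simpa [EuclideanSpace.inner_single_right] using
      integrable_of_mem_interior_integrableExpSet hmem
  simp only [PiLp.inner_apply, meanVec, RCLike.inner_apply, conj_trivial]
  rw [integral_finsetSum _ fun i _ => (hint i).const_mul _]
  simp [integral_const_mul]

theorem hasSubgaussianMGF_inner_sub_meanVec [IsProbabilityMeasure μ] (ht : 0 < t)
    (hμ : IsStronglyLogConcaveMeasure t μ)
    (hθ : ‖θ‖ = 1) :
    HasSubgaussianMGF (fun x => ⟪x - meanVec μ, θ⟫) (Real.toNNReal t⁻¹) μ := by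
  have he : ∀ s x, Real.exp (s * ⟪x - meanVec μ, θ⟫)
      = Real.exp (s * ⟪x, θ⟫) * Real.exp (-(s * ∫ x, ⟪x, θ⟫ ∂μ)) := by
    intro s x
    rw [inner_sub_left, inner_meanVec ht hμ, ← Real.exp_add]
    ring_nf
  refine ⟨fun s => ?_, fun s => ?_⟩
  · simp_rw [he]
    exact (integrable_exp_mul_inner ht hμ hθ s).mul_const _
  · rw [mgf]
    simp_rw [he]
    rw [integral_mul_const]
    have h1 : ∫ x, Real.exp (s * ⟪x, θ⟫) ∂μ = Real.exp (cgf (fun x => ⟪x, θ⟫) μ s) :=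
      (exp_cgf (integrable_exp_mul_inner ht hμ hθ s)).symm
    rw [h1, ← Real.exp_add, Real.coe_toNNReal _ (inv_pos.2 ht).le]
    refine Real.exp_le_exp.2 ?_
    have h2 := cgf_inner_le ht hμ hθ s
    have h3 : s ^ 2 / (2 * t) = t⁻¹ * s ^ 2 / 2 := by field_simp
    linarith

end Laplace

section Moments

open ProbabilityTheory

variable {Ω : Type*} [MeasurableSpace Ω] {μ : Measure Ω} {X : Ω → ℝ}
  {c : NNReal}

theorem integral_le_of_le_exp_add_exp (hX : HasSubgaussianMGF X c μ) (s : ℝ) {F : Ω → ℝ} {k : ℝ}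
    (hk : 0 ≤ k) (hF : Integrable F μ)
    (h : ∀ ω, F ω ≤ k * (Real.exp (s * X ω) + Real.exp (-s * X ω))) :
    ∫ ω, F ω ∂μ ≤ 2 * k * Real.exp (c * s ^ 2 / 2) := by
  have h1 := hX.mgf_le s
  have h2 := hX.mgf_le (-s)
  rw [mgf] at h1 h2
  rw [neg_sq] at h2
  calc ∫ ω, F ω ∂μ ≤ ∫ ω, k * (Real.exp (s * X ω) + Real.exp (-s * X ω)) ∂μ :=
        integral_mono hF (((hX.integrable_exp_mul s).add (hX.integrable_exp_mul (-s))).const_mul k) h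
    _ = k * (∫ ω, Real.exp (s * X ω) ∂μ + ∫ ω, Real.exp (-s * X ω) ∂μ) := by
        rw [integral_const_mul, integral_add (hX.integrable_exp_mul s) (hX.integrable_exp_mul (-s))]
    _ ≤ k * (Real.exp (c * s ^ 2 / 2) + Real.exp (c * s ^ 2 / 2)) := by gcongr
    _ = _ := by ring

theorem integrable_abs_rpow_of_hasSubgaussianMGF (hX : HasSubgaussianMGF X c μ) {p : ℝ}
    (hp : 0 ≤ p) : Integrable (fun ω => |X ω| ^ p) μ :=
  integrable_rpow_abs_of_mem_interior_integrableExpSet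
    (by simp [hX.integrableExpSet_eq_univ]) hp

theorem one_add_sq_div_two_le_cosh (x : ℝ) : 1 + x ^ 2 / 2 ≤ Real.cosh x := by
  have h1 : |x / 2| ≤ |Real.sinh (x / 2)| := by
    rw [Real.abs_sinh]
    exact Real.self_le_sinh_iff.2 (abs_nonneg _)
  have h2 := sq_le_sq.2 h1
  have h3 := Real.cosh_two_mul (x / 2)
  rw [Real.cosh_sq, mul_div_cancel₀ x two_ne_zero] at h3
  linarith

theorem integral_sq_le_of_hasSubgaussianMGF [IsProbabilityMeasure μ]
    (hX : HasSubgaussianMGF X c μ) :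
    ∫ ω, X ω ^ 2 ∂μ ≤ c := by
  have hint : Integrable (fun ω => X ω ^ 2) μ := by
    simpa using integrable_abs_rpow_of_hasSubgaussianMGF hX (p := 2) (by norm_num)
  set V := ∫ ω, X ω ^ 2 ∂μ
  have hV : 0 ≤ V := integral_nonneg fun ω => sq_nonneg _
  have hbound : ∀ s : ℝ, 0 < s → V * (1 - c * s ^ 2 / 2) ≤ c := by
    intro s hs
    have h := integral_le_of_le_exp_add_exp hX s (F := fun ω => 1 + s ^ 2 / 2 * X ω ^ 2)
      (k := 1 / 2) (by norm_num) ((integrable_const _).add (hint.const_mul _)) fun ω => by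
        have h := one_add_sq_div_two_le_cosh (s * X ω)
        rw [Real.cosh_eq, ← neg_mul] at h
        nlinarith
    rw [integral_add (integrable_const _) (hint.const_mul _), integral_const_mul] at h
    simp only [integral_const, probReal_univ, smul_eq_mul, mul_one] at h
    rcases le_total (1 - c * s ^ 2 / 2) 0 with hu | hu
    · exact (mul_nonpos_of_nonneg_of_nonpos hV hu).trans c.2
    · have hexp : Real.exp (c * s ^ 2 / 2) * (1 - c * s ^ 2 / 2) ≤ 1 := by
        calc _ ≤ Real.exp (c * s ^ 2 / 2) * Real.exp (-(c * s ^ 2 / 2)) := by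
              gcongr
              exact Real.one_sub_le_exp_neg _
          _ = 1 := by rw [← Real.exp_add, add_neg_cancel, Real.exp_zero]
      have h' := mul_le_mul_of_nonneg_right h hu
      have hs2 : 0 < s ^ 2 / 2 := by positivity
      refine le_of_mul_le_mul_left ?_ hs2
      linarith
  have hlim : Tendsto (fun s : ℝ => V * (1 - c * s ^ 2 / 2)) (𝓝[>] 0) (𝓝 V) := by
    have h : Continuous fun s : ℝ => V * (1 - c * s ^ 2 / 2) := by fun_prop
    simpa using (h.tendsto 0).mono_left nhdsWithin_le_nhds
  exact le_of_tendsto hlim (eventually_mem_nhdsWithin.mono fun s hs => hbound s hs)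

theorem abs_rpow_le_exp {x p s : ℝ} (hp : 0 < p) (hs : 0 < s) :
    |x| ^ p ≤ (p / s) ^ p * Real.exp (-p) * (Real.exp (s * x) + Real.exp (-s * x)) := by
  have h1 : s * |x| / p ≤ Real.exp (s * |x| / p - 1) := by
    simpa using Real.add_one_le_exp (s * |x| / p - 1)
  have h2 : |x| ≤ p / s * Real.exp (s * |x| / p - 1) := by
    calc |x| = p / s * (s * |x| / p) := by field_simp
      _ ≤ _ := by gcongr
  have h3 : Real.exp (s * |x|) ≤ Real.exp (s * x) + Real.exp (-s * x) := by
    rcases abs_cases x with ⟨h, -⟩ | ⟨h, -⟩ <;> rw [h]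
    · linarith [Real.exp_pos (-s * x)]
    · rw [mul_neg, ← neg_mul]; linarith [Real.exp_pos (s * x)]
  calc |x| ^ p ≤ (p / s * Real.exp (s * |x| / p - 1)) ^ p := by gcongr
    _ = (p / s) ^ p * Real.exp (-p) * Real.exp (s * |x|) := by
      rw [Real.mul_rpow (by positivity) (Real.exp_pos _).le, ← Real.exp_mul, mul_assoc,
        ← Real.exp_add]
      congr 2
      field_simp
      ring
    _ ≤ _ := by gcongr

theorem integral_abs_rpow_le_of_two_le (hX : HasSubgaussianMGF X c μ) (hc : 0 < c) {p : ℝ}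
    (hp : 2 ≤ p) : ∫ ω, |X ω| ^ p ∂μ ≤ (p * c) ^ (p / 2) := by
  have hp0 : 0 < p := by linarith
  have hc' : (0 : ℝ) < c := hc
  have hs : 0 < Real.sqrt (p / c) := by positivity
  refine (integral_le_of_le_exp_add_exp hX (Real.sqrt (p / c)) (by positivity)
    (integrable_abs_rpow_of_hasSubgaussianMGF hX hp0.le) fun ω => abs_rpow_le_exp hp0 hs).trans ?_
  have h1 : p / Real.sqrt (p / c) = Real.sqrt (p * c) := by
    rw [div_eq_iff hs.ne', ← Real.sqrt_mul (by positivity)]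
    have : p * c * (p / c) = p ^ 2 := by field_simp
    rw [this, Real.sqrt_sq hp0.le]
  have h2 : (c : ℝ) * Real.sqrt (p / c) ^ 2 / 2 = p / 2 := by
    rw [Real.sq_sqrt (by positivity)]; field_simp
  have h3 : Real.sqrt (p * c) ^ p = (p * c) ^ (p / 2) := by
    rw [Real.sqrt_eq_rpow, ← Real.rpow_mul (by positivity)]; ring_nf
  rw [h1, h2, h3]
  have h4 : 2 * Real.exp (-(p / 2)) ≤ 1 := by
    rw [Real.exp_neg, ← div_eq_mul_inv, div_le_one (Real.exp_pos _)]
    linarith [Real.add_one_le_exp (p / 2)]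
  calc 2 * ((p * c) ^ (p / 2) * Real.exp (-p)) * Real.exp (p / 2)
      = (p * c) ^ (p / 2) * (2 * (Real.exp (-p) * Real.exp (p / 2))) := by ring
    _ = (p * c) ^ (p / 2) * (2 * Real.exp (-(p / 2))) := by rw [← Real.exp_add]; ring_nf
    _ ≤ (p * c) ^ (p / 2) * 1 := by gcongr
    _ = _ := mul_one _

theorem integral_abs_rpow_le_of_le_two [IsProbabilityMeasure μ] (hX : HasSubgaussianMGF X c μ)
    (hc : 0 < c) {p : ℝ}
    (hp1 : 1 ≤ p) (hp2 : p ≤ 2) : ∫ ω, |X ω| ^ p ∂μ ≤ (p * c) ^ (p / 2) := by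
  have hc' : (0 : ℝ) < c := hc
  have hint : Integrable (fun ω => X ω ^ 2) μ := by
    simpa using integrable_abs_rpow_of_hasSubgaussianMGF hX (p := 2) (by norm_num)
  have hpt : ∀ ω, |X ω| ^ p ≤ (c : ℝ) ^ (p / 2) * (1 - p / 2 + p / 2 / c * X ω ^ 2) := by
    intro ω
    have h1 : |X ω| ^ p = (c : ℝ) ^ (p / 2) * (1 + (X ω ^ 2 / c - 1)) ^ (p / 2) := by
      rw [← Real.mul_rpow hc'.le (by rw [add_sub_cancel]; positivity), add_sub_cancel,
        mul_div_cancel₀ _ hc'.ne', ← sq_abs, ← Real.rpow_natCast, ← Real.rpow_mul (abs_nonneg _)]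
      congr 1
      push_cast
      ring
    have h2 : (1 + (X ω ^ 2 / c - 1)) ^ (p / 2) ≤ 1 + p / 2 * (X ω ^ 2 / c - 1) :=
      rpow_one_add_le_one_add_mul_self (by linarith [show 0 ≤ X ω ^ 2 / c by positivity])
        (by linarith) (by linarith)
    rw [h1]
    gcongr
    refine h2.trans_eq ?_
    ring
  calc ∫ ω, |X ω| ^ p ∂μ
      ≤ ∫ ω, (c : ℝ) ^ (p / 2) * (1 - p / 2 + p / 2 / c * X ω ^ 2) ∂μ :=
        integral_mono (integrable_abs_rpow_of_hasSubgaussianMGF hX (by linarith))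
          (((integrable_const _).add (hint.const_mul _)).const_mul _) hpt
    _ = (c : ℝ) ^ (p / 2) * (1 - p / 2 + p / 2 / c * ∫ ω, X ω ^ 2 ∂μ) := by
        rw [integral_const_mul, integral_add (integrable_const _) (hint.const_mul _),
          integral_const_mul]
        simp
    _ ≤ (c : ℝ) ^ (p / 2) * (1 - p / 2 + p / 2 / c * c) := by
        have := integral_sq_le_of_hasSubgaussianMGF hX
        gcongr
    _ = (1 * c : ℝ) ^ (p / 2) := by rw [div_mul_cancel₀ _ hc'.ne']; simp
    _ ≤ (p * c) ^ (p / 2) := by gcongr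

theorem integral_abs_rpow_rpow_le [IsProbabilityMeasure μ] (hX : HasSubgaussianMGF X c μ)
    (hc : 0 < c) {p : ℝ}
    (hp : 1 ≤ p) : (∫ ω, |X ω| ^ p ∂μ) ^ (1 / p) ≤ Real.sqrt (p * c) := by
  have h : ∫ ω, |X ω| ^ p ∂μ ≤ (p * c) ^ (p / 2) := by
    rcases le_total 2 p with h | h
    · exact integral_abs_rpow_le_of_two_le hX hc h
    · exact integral_abs_rpow_le_of_le_two hX hc hp h
  calc (∫ ω, |X ω| ^ p ∂μ) ^ (1 / p) ≤ ((p * c) ^ (p / 2)) ^ (1 / p) := by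
        have h0 : 0 ≤ ∫ ω, |X ω| ^ p ∂μ := integral_nonneg fun ω => by positivity
        gcongr
    _ = Real.sqrt (p * c) := by
        rw [← Real.rpow_mul (by positivity), Real.sqrt_eq_rpow]
        congr 1
        field_simp

end Moments

/-- A `t`-strongly log-concave random vector `X` in `ℝⁿ` (identified with its law
`μ`) is `(1/√t)`-subgaussian: for every `p ≥ 1` and every unit vector `θ`,
`(𝔼 |⟨X - 𝔼X, θ⟩|ᵖ)^{1/p} ≤ √(p/t)`. -/
theorem strongly_logconcave_subgaussian {n : ℕ} (t : ℝ) (ht : 0 < t)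
    (μ : Measure (EuclideanSpace ℝ (Fin n))) (hprob : IsProbabilityMeasure μ)
    (hslc : IsStronglyLogConcaveMeasure t μ) :
    ∀ p : ℝ, 1 ≤ p → ∀ θ : EuclideanSpace ℝ (Fin n), ‖θ‖ = 1 →
      (∫ x, |⟪x - meanVec μ, θ⟫| ^ p ∂μ) ^ (1 / p) ≤ Real.sqrt (p / t) := by
  intro p hp θ hθ
  have h := integral_abs_rpow_rpow_le (hasSubgaussianMGF_inner_sub_meanVec ht hslc hθ)
    (Real.toNNReal_pos.2 (inv_pos.2 ht)) hp
  rwa [Real.coe_toNNReal _ (inv_pos.2 ht).le, ← div_eq_mul_inv] at h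

end
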